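/- Boundary distance preserving property: Let D and D′ be bounded strictly pseudoconvex domains with C^∞ boundary in ℝ^{2n}, with respect to smooth almost complex structures J and J′ defined on neighborhoods of the closures of D and D′ respectively, and let f : D → D′ be a (J,J′)-biholomorphism. Then there exists a constant C > 0 such that (1/C)·dist(f(z), ∂D′) ≤ dist(z, ∂D) ≤ C·dist(f(z), ∂D′) for every z ∈ D. -/

import Mathlib

open Complex Metric Set MeasureTheory Filter Topology Bornology ENNReal

noncomputable section

/-- We identify `ℝ^{2n}` with `ℂⁿ` (with the Euclidean norm). -/
abbrev Cn (n : ℕ) : Type := EuclideanSpace ℂ (Fin n)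

/-- The standard complex structure on `ℂⁿ ≅ ℝ^{2n}`: multiplication by `i`,
viewed as an `ℝ`-linear map. -/
def Jstd (n : ℕ) : Cn n →L[ℝ] Cn n :=
  ContinuousLinearMap.restrictScalars ℝ (Complex.I • ContinuousLinearMap.id ℂ (Cn n))

/-- The standard complex structure on `ℂ ≅ ℝ²`. -/
def JstdC : ℂ →L[ℝ] ℂ :=
  ContinuousLinearMap.restrictScalars ℝ (Complex.I • ContinuousLinearMap.id ℂ ℂ)

/-- `J` is a (smooth) almost complex structure on the set `Ω ⊆ ℂⁿ ≅ ℝ^{2n}`: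
a `C^∞` field of linear automorphisms with `J(x) ∘ J(x) = -Id`. -/
def IsACS {n : ℕ} (Ω : Set (Cn n)) (J : Cn n → Cn n →L[ℝ] Cn n) : Prop :=
  ContDiffOn ℝ (⊤ : ℕ∞) J Ω ∧ ∀ x ∈ Ω, (J x).comp (J x) = -ContinuousLinearMap.id ℝ (Cn n)

/-- The open unit disc `Δ` in `ℂ`. -/
def unitDisc : Set ℂ := Metric.ball 0 1

/-- A map between (subsets of) almost complex spaces is `(J,J')`-holomorphic on `s` if
`df_x ∘ J(x) = J'(f(x)) ∘ df_x` on `s`. -/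
def PseudoHolOn {n m : ℕ} (J : Cn n → Cn n →L[ℝ] Cn n) (J' : Cn m → Cn m →L[ℝ] Cn m)
    (f : Cn n → Cn m) (s : Set (Cn n)) : Prop :=
  ∀ x ∈ s, DifferentiableAt ℝ f x ∧
    (fderiv ℝ f x).comp (J x) = (J' (f x)).comp (fderiv ℝ f x)

/-- A map from an open subset of `ℂ` is `J`-holomorphic on `s` if
`df_ζ ∘ J_st = J(f(ζ)) ∘ df_ζ` on `s`. -/
def JHolOn {n : ℕ} (J : Cn n → Cn n →L[ℝ] Cn n) (f : ℂ → Cn n) (s : Set ℂ) : Prop :=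
  ∀ ζ ∈ s, DifferentiableAt ℝ f ζ ∧
    (fderiv ℝ f ζ).comp JstdC = (J (f ζ)).comp (fderiv ℝ f ζ)

/-- A `J`-holomorphic disc in `D`. -/
def JDisc {n : ℕ} (J : Cn n → Cn n →L[ℝ] Cn n) (D : Set (Cn n)) (f : ℂ → Cn n) : Prop :=
  MapsTo f unitDisc D ∧ JHolOn J f unitDisc

/-- The nonnegative part of an extended real number, as an element of `ℝ≥0∞`. -/
def erealPos (x : EReal) : ℝ≥0∞ := if x = ⊤ then ⊤ else ENNReal.ofReal x.toReal

/-- The integral of an `EReal`-valued function: the (unsigned) integral of the positive part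
minus the integral of the negative part. -/
def erealIntegral {X : Type} [MeasurableSpace X] (μ : Measure X) (g : X → EReal) : EReal :=
  ((∫⁻ x, erealPos (g x) ∂μ : ℝ≥0∞) : EReal) - ((∫⁻ x, erealPos (-(g x)) ∂μ : ℝ≥0∞) : EReal)

/-- `h : ℂ → [-∞,∞)` is subharmonic on `s`: upper semicontinuous and satisfying the
sub-mean-value inequality `h(a) ≤ (2π)⁻¹ ∫₀^{2π} h(a + r e^{iθ}) dθ` whenever the closed disc
of center `a` and radius `r` is contained in `s`. -/
def SubharmonicOnE (h : ℂ → EReal) (s : Set ℂ) : Prop :=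
  UpperSemicontinuousOn h s ∧
  ∀ a : ℂ, ∀ r : ℝ, 0 < r → Metric.closedBall a r ⊆ s →
    h a ≤ (((2 * Real.pi)⁻¹ : ℝ) : EReal) *
      erealIntegral (volume.restrict (Set.Ioc (0 : ℝ) (2 * Real.pi)))
        (fun θ : ℝ => h (a + (r : ℂ) * Complex.exp ((θ : ℂ) * Complex.I)))

/-- `u : Ω → [-∞,∞)` is `J`-plurisubharmonic on `Ω`: upper semicontinuous, and `u ∘ f` is
subharmonic on `Δ` for every `J`-holomorphic disc `f : Δ → Ω`. -/
def JPshOn {n : ℕ} (J : Cn n → Cn n →L[ℝ] Cn n) (Ω : Set (Cn n)) (u : Cn n → EReal) : Prop :=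
  UpperSemicontinuousOn u Ω ∧
  ∀ f : ℂ → Cn n, JDisc J Ω f → SubharmonicOnE (fun ζ => u (f ζ)) unitDisc

/-- Real-valued `J`-plurisubharmonic functions. -/
def JPshOnR {n : ℕ} (J : Cn n → Cn n →L[ℝ] Cn n) (Ω : Set (Cn n)) (u : Cn n → ℝ) : Prop :=
  JPshOn J Ω (fun x => (u x : EReal))

/-- The `1`-form `J*dr : w ↦ dr_x(J(x)w)`. -/
def JStarDr {n : ℕ} (J : Cn n → Cn n →L[ℝ] Cn n) (r : Cn n → ℝ) (x : Cn n) : Cn n →L[ℝ] ℝ :=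
  (fderiv ℝ r x).comp (J x)

/-- The Levi form of a `C²` function `r`:
`L^J_r(p,v) = -d(J*dr)_p(v, J(p)v)` where `dα_p(u,w) = (∂_u α)_p(w) - (∂_w α)_p(u)`. -/
def LeviForm {n : ℕ} (J : Cn n → Cn n →L[ℝ] Cn n) (r : Cn n → ℝ) (p v : Cn n) : ℝ :=
  -((fderiv ℝ (JStarDr J r) p v) (J p v) - (fderiv ℝ (JStarDr J r) p (J p v)) v)

/-- `r` is strictly `J`-plurisubharmonic on `S`: its Levi form is positive definite there. -/
def StrictJPshOn {n : ℕ} (J : Cn n → Cn n →L[ℝ] Cn n) (r : Cn n → ℝ) (S : Set (Cn n)) : Prop :=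
  ∀ p ∈ S, ∀ v : Cn n, v ≠ 0 → 0 < LeviForm J r p v

/-- The Kobayashi–Royden infinitesimal pseudometric of `(D,J)`:
`K(p,v) = inf {α > 0 : ∃ J-holomorphic disc f : Δ → D, f(0) = p, df_0(∂/∂x) = v/α}`. -/
def kobMetric {n : ℕ} (J : Cn n → Cn n →L[ℝ] Cn n) (D : Set (Cn n)) (p v : Cn n) : ℝ :=
  sInf {α : ℝ | 0 < α ∧ ∃ f : ℂ → Cn n, JDisc J D f ∧ f 0 = p ∧ fderiv ℝ f 0 1 = α⁻¹ • v}

/-- A piecewise `C¹` path `γ : [0,1] → ℝ^{2n}`. -/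
def PiecewiseC1On {n : ℕ} (γ : ℝ → Cn n) : Prop :=
  ContinuousOn γ (Set.Icc 0 1) ∧
  ∃ (m : ℕ) (t : ℕ → ℝ), t 0 = 0 ∧ t m = 1 ∧ (∀ i < m, t i < t (i + 1)) ∧
    ∀ i < m, ContDiffOn ℝ 1 γ (Set.Icc (t i) (t (i + 1)))

/-- The (integrated) Kobayashi pseudodistance of `(D,J)`: the infimum of the Kobayashi–Royden
lengths of piecewise `C¹` paths in `D` joining `p` to `q`. -/
def kobDist {n : ℕ} (J : Cn n → Cn n →L[ℝ] Cn n) (D : Set (Cn n)) (p q : Cn n) : ℝ :=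
  sInf {L : ℝ | ∃ γ : ℝ → Cn n, PiecewiseC1On γ ∧ MapsTo γ (Set.Icc 0 1) D ∧
    γ 0 = p ∧ γ 1 = q ∧ L = ∫ t in (0 : ℝ)..1, kobMetric J D (γ t) (deriv γ t)}

/-- The cluster set of `f` (defined on `S`) along `A ⊆ closure S`: all limits of sequences
`f(s_k)` where `s_k ∈ S` converges to a point of `A`. -/
def clusterSet {X Y : Type*} [TopologicalSpace X] [TopologicalSpace Y]
    (f : X → Y) (S A : Set X) : Set Y :=
  {y | ∃ u : ℕ → X, (∀ k, u k ∈ S) ∧ (∃ a ∈ A, Tendsto u atTop (𝓝 a)) ∧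
    Tendsto (fun k => f (u k)) atTop (𝓝 y)}

/-- `N` is a `d`-dimensional `C^∞` submanifold of `ℂⁿ ≅ ℝ^{2n}`: near every point it can be
straightened, by a `C^∞` diffeomorphism onto an open subset of `ℝ^{2n}`, to the coordinate
subspace spanned by the first `d` coordinates. -/
def IsSmoothSubmanifold {n : ℕ} (d : ℕ) (N : Set (Cn n)) : Prop :=
  ∀ p ∈ N, ∃ (U : Set (Cn n)) (V : Set (EuclideanSpace ℝ (Fin (2 * n))))
    (φ : Cn n → EuclideanSpace ℝ (Fin (2 * n))) (ψ : EuclideanSpace ℝ (Fin (2 * n)) → Cn n),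
    IsOpen U ∧ p ∈ U ∧ IsOpen V ∧ ContDiffOn ℝ (⊤ : ℕ∞) φ U ∧ ContDiffOn ℝ (⊤ : ℕ∞) ψ V ∧
    (∀ x ∈ U, ψ (φ x) = x) ∧ (∀ y ∈ V, φ (ψ y) = y) ∧ MapsTo φ U V ∧
    φ '' (N ∩ U) = V ∩ {x | ∀ i : Fin (2 * n), d ≤ (i : ℕ) → x i = 0}

/-- The tangent set of `N ⊆ ℂⁿ` at `p`: velocities at `0` of differentiable curves through `p`
staying in `N` near time `0`. For a `C^∞` submanifold this is the tangent space `T_pN`. -/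
def TangentSet {n : ℕ} (N : Set (Cn n)) (p : Cn n) : Set (Cn n) :=
  {v | ∃ γ : ℝ → Cn n, γ 0 = p ∧ (∀ᶠ t in 𝓝 (0 : ℝ), γ t ∈ N) ∧
    DifferentiableAt ℝ γ 0 ∧ deriv γ 0 = v}

/-- `N` is totally real for `J`: `T_pN ∩ J(p)(T_pN) = {0}` at every `p ∈ N`. -/
def TotallyReal {n : ℕ} (J : Cn n → Cn n →L[ℝ] Cn n) (N : Set (Cn n)) : Prop :=
  ∀ p ∈ N, ∀ v ∈ TangentSet N p, J p v ∈ TangentSet N p → v = 0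

/-- `ρ` is a (global) `C^∞` defining function of `D`, defined on the neighborhood `Ω` of the
closure of `D`, with nonvanishing differential on `∂D`.  (This encodes that `D` has
`C^∞` boundary.) -/
def DefiningFunction {n : ℕ} (D Ω : Set (Cn n)) (ρ : Cn n → ℝ) : Prop :=
  IsOpen Ω ∧ closure D ⊆ Ω ∧ ContDiffOn ℝ (⊤ : ℕ∞) ρ Ω ∧
  D = {x ∈ Ω | ρ x < 0} ∧ ∀ x ∈ frontier D, fderiv ℝ ρ x ≠ 0

/-- `D` is a bounded strictly `J`-pseudoconvex domain with `C^∞` boundary: it admits a smooth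
defining function which is `J`-plurisubharmonic on `D` and strictly `J`-plurisubharmonic on a
neighborhood of `∂D`. -/
def StrictlyPseudoconvexDomain {n : ℕ} (J : Cn n → Cn n →L[ℝ] Cn n) (D : Set (Cn n)) : Prop :=
  IsOpen D ∧ IsConnected D ∧ IsBounded D ∧
  ∃ (Ω : Set (Cn n)) (ρ : Cn n → ℝ), DefiningFunction D Ω ρ ∧
    JPshOnR J D ρ ∧ ∃ W : Set (Cn n), IsOpen W ∧ frontier D ⊆ W ∧ StrictJPshOn J ρ W

end

theorem two_le_smooth : (2 : WithTop ℕ∞) ≤ ((⊤ : ℕ∞) : WithTop ℕ∞) :=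
  WithTop.coe_le_coe.2 (le_top : (2 : ℕ∞) ≤ ⊤)

theorem one_le_smooth : (1 : WithTop ℕ∞) ≤ ((⊤ : ℕ∞) : WithTop ℕ∞) :=
  WithTop.coe_le_coe.2 (le_top : (1 : ℕ∞) ≤ ⊤)

theorem one_add_one_le_smooth : (1 : WithTop ℕ∞) + 1 ≤ ((⊤ : ℕ∞) : WithTop ℕ∞) := by
  rw [one_add_one_eq_two]; exact two_le_smooth

/-- Second-order necessary condition at a local maximum. -/
theorem snd_deriv_nonpos {n : ℕ} {h : Cn n → ℝ} {p : Cn n} (hh : ContDiffAt ℝ 2 h p)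
    (hm : IsLocalMax h p) (v : Cn n) : fderiv ℝ (fderiv ℝ h) p v v ≤ 0 := by
  by_contra! hpos
  let l : ℝ → Cn n := fun t => p + t • v
  have hl : ∀ t, HasDerivAt l v t := fun t => by
    have := ((hasDerivAt_id t).smul_const v).const_add p
    simpa [l] using this
  have hl0 : l 0 = p := by simp [l]
  have hlc : Tendsto l (𝓝 0) (𝓝 p) := by
    have := (hl 0).continuousAt.tendsto
    rwa [hl0] at this
  have hd : ∀ᶠ x in 𝓝 p, DifferentiableAt ℝ h x := by
    filter_upwards [hh.eventually (by simp)] with x hx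
    exact hx.differentiableAt (by simp)
  have e1 : ∀ᶠ t in 𝓝 (0:ℝ), deriv (h ∘ l) t = fderiv ℝ h (l t) v := by
    filter_upwards [hlc.eventually hd] with t ht
    exact (ht.hasFDerivAt.comp_hasDerivAt t (hl t)).deriv
  have hd2 : DifferentiableAt ℝ (fderiv ℝ h) p :=
    (hh.fderiv_right (m := 1) (by norm_num)).differentiableAt (by simp)
  have e2 : HasDerivAt (fun t => fderiv ℝ h (l t) v) (fderiv ℝ (fderiv ℝ h) p v v) 0 := by
    have h1 : HasFDerivAt (fderiv ℝ h) (fderiv ℝ (fderiv ℝ h) p) (l 0) := by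
      rw [hl0]; exact hd2.hasFDerivAt
    have h2 := h1.comp_hasDerivAt (0:ℝ) (hl 0)
    simpa using h2.clm_apply (hasDerivAt_const (0:ℝ) v)
  have e3 : deriv (deriv (h ∘ l)) 0 = fderiv ℝ (fderiv ℝ h) p v v := by
    rw [Filter.EventuallyEq.deriv_eq e1]; exact e2.deriv
  have e4 : deriv (h ∘ l) 0 = 0 := by
    rw [e1.self_of_nhds, hl0, hm.fderiv_eq_zero]; simp
  have hcont : ContinuousAt (h ∘ l) 0 := by
    refine ContinuousAt.comp ?_ (hl 0).continuousAt
    rw [hl0]; exact hh.continuousAt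
  have hmin := isLocalMin_of_deriv_deriv_pos (by rw [e3]; exact hpos) e4 hcont
  have hmax : ∀ᶠ t in 𝓝 (0:ℝ), (h ∘ l) t ≤ (h ∘ l) 0 := by
    simp only [Function.comp, hl0]
    exact hlc.eventually hm
  have hconst : (h ∘ l) =ᶠ[𝓝 0] fun _ => (h ∘ l) 0 := by
    filter_upwards [hmin, hmax] with t h1 h2
    exact le_antisymm h2 h1
  have h0 : deriv (deriv (h ∘ l)) 0 = 0 := by
    rw [hconst.deriv.deriv_eq]; simp
  rw [e3] at h0
  linarith

/-- The Levi form is nonpositive at a local maximum. -/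
theorem levi_nonpos {n : ℕ} {J : Cn n → Cn n →L[ℝ] Cn n} {h : Cn n → ℝ} {p : Cn n}
    (hh : ContDiffAt ℝ 2 h p) (hJ : DifferentiableAt ℝ J p)
    (hJ2 : (J p).comp (J p) = -ContinuousLinearMap.id ℝ (Cn n))
    (hm : IsLocalMax h p) (v : Cn n) : LeviForm J h p v ≤ 0 := by
  have hd2 : DifferentiableAt ℝ (fderiv ℝ h) p :=
    (hh.fderiv_right (m := 1) (by norm_num)).differentiableAt (by simp)
  have key : ∀ a b, fderiv ℝ (JStarDr J h) p a b = fderiv ℝ (fderiv ℝ h) p a (J p b) := by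
    intro a b
    have := (hd2.hasFDerivAt.clm_comp hJ.hasFDerivAt).fderiv
    have e : JStarDr J h = fun x => (fderiv ℝ h x).comp (J x) := rfl
    rw [e, this]
    simp [hm.fderiv_eq_zero]
  have hJJ : J p (J p v) = -v := by
    have := congrArg (fun L => L v) hJ2
    simpa using this
  unfold LeviForm
  rw [key, key, hJJ]
  have h1 := snd_deriv_nonpos hh hm v
  have h2 := snd_deriv_nonpos hh hm (J p v)
  simp only [map_neg]
  linarith

/-- Biholomorphic invariance of the Levi form. -/
theorem levi_comp {n : ℕ} {J J' : Cn n → Cn n →L[ℝ] Cn n} {r : Cn n → ℝ} {f : Cn n → Cn n}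
    {p : Cn n} (hr : ContDiffAt ℝ 2 r (f p)) (hf : ContDiffAt ℝ 2 f p)
    (hJ' : DifferentiableAt ℝ J' (f p))
    (hol : ∀ᶠ x in 𝓝 p, (fderiv ℝ f x).comp (J x) = (J' (f x)).comp (fderiv ℝ f x))
    (v : Cn n) : LeviForm J (fun x => r (f x)) p v = LeviForm J' r (f p) (fderiv ℝ f p v) := by
  have hrd : ∀ᶠ x in 𝓝 p, DifferentiableAt ℝ r (f x) := by
    have : ∀ᶠ x in 𝓝 (f p), DifferentiableAt ℝ r x := by
      filter_upwards [hr.eventually (by simp)] with x hx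
      exact hx.differentiableAt (by simp)
    exact hf.continuousAt.eventually this
  have hfd : ∀ᶠ x in 𝓝 p, DifferentiableAt ℝ f x := by
    filter_upwards [hf.eventually (by simp)] with x hx
    exact hx.differentiableAt (by simp)
  have e : JStarDr J (fun x => r (f x)) =ᶠ[𝓝 p]
      fun x => (JStarDr J' r (f x)).comp (fderiv ℝ f x) := by
    filter_upwards [hrd, hfd, hol] with x h1 h2 h3
    unfold JStarDr
    have : fderiv ℝ (fun x => r (f x)) x = (fderiv ℝ r (f x)).comp (fderiv ℝ f x) :=
      fderiv_comp x h1 h2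
    rw [this, ContinuousLinearMap.comp_assoc, h3, ContinuousLinearMap.comp_assoc]
  have hd2r : DifferentiableAt ℝ (fderiv ℝ r) (f p) :=
    (hr.fderiv_right (m := 1) (by norm_num)).differentiableAt (by simp)
  have hd2f : DifferentiableAt ℝ (fderiv ℝ f) p :=
    (hf.fderiv_right (m := 1) (by norm_num)).differentiableAt (by simp)
  have hα : DifferentiableAt ℝ (JStarDr J' r) (f p) := hd2r.clm_comp hJ'
  have hαf : HasFDerivAt (fun x => JStarDr J' r (f x))
      ((fderiv ℝ (JStarDr J' r) (f p)).comp (fderiv ℝ f p)) p :=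
    hα.hasFDerivAt.comp p hfd.self_of_nhds.hasFDerivAt
  have hfin := (hαf.clm_comp hd2f.hasFDerivAt).fderiv
  have hsymm : IsSymmSndFDerivAt ℝ f p := hf.isSymmSndFDerivAt (by simp)
  have h3 : fderiv ℝ f p (J p v) = J' (f p) (fderiv ℝ f p v) := by
    have := congrArg (fun L => L v) hol.self_of_nhds
    simpa using this
  unfold LeviForm
  rw [e.fderiv_eq, hfin]
  have hs := hsymm.eq v (J p v)
  simp [h3, hs]

/-- Levi form of the comparison function. -/
theorem levi_barrier {n : ℕ} {J : Cn n → Cn n →L[ℝ] Cn n} {u r : Cn n → ℝ} {p : Cn n}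
    (hu : ContDiffAt ℝ 2 u p) (hr : ContDiffAt ℝ 2 r p) (hJ : DifferentiableAt ℝ J p)
    (hJ2 : (J p).comp (J p) = -ContinuousLinearMap.id ℝ (Cn n)) (A ε : ℝ) (v : Cn n) :
    LeviForm J (fun x => u x - ε * (1 - Real.exp (-A * r x))) p v =
      LeviForm J u p v - ε * A * Real.exp (-A * r p) *
        (LeviForm J r p v - A * ((fderiv ℝ r p v) ^ 2 + (fderiv ℝ r p (J p v)) ^ 2)) := by
  have hud : ∀ᶠ x in 𝓝 p, DifferentiableAt ℝ u x := by
    filter_upwards [hu.eventually (by simp)] with x hx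
    exact hx.differentiableAt (by simp)
  have hrd : ∀ᶠ x in 𝓝 p, DifferentiableAt ℝ r x := by
    filter_upwards [hr.eventually (by simp)] with x hx
    exact hx.differentiableAt (by simp)
  have hexp : ∀ x, DifferentiableAt ℝ r x → HasFDerivAt (fun x => Real.exp (-A * r x))
      ((-A * Real.exp (-A * r x)) • fderiv ℝ r x) x := by
    intro x hx
    have := (hx.hasFDerivAt.const_mul (-A)).exp
    rw [smul_smul, mul_comm] at this
    exact this
  have e : JStarDr J (fun x => u x - ε * (1 - Real.exp (-A * r x))) =ᶠ[𝓝 p]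
      fun x => JStarDr J u x - (ε * A * Real.exp (-A * r x)) • JStarDr J r x := by
    filter_upwards [hud, hrd] with x h1 h2
    have := (h1.hasFDerivAt.sub (((hexp x h2).const_sub 1).const_mul ε)).fderiv
    unfold JStarDr
    have e : fderiv ℝ (fun x => u x - ε * (1 - Real.exp (-A * r x))) x = _ := this
    rw [e]
    ext w
    simp
    ring
  have hd2u : DifferentiableAt ℝ (fderiv ℝ u) p :=
    (hu.fderiv_right (m := 1) (by norm_num)).differentiableAt (by simp)
  have hd2r : DifferentiableAt ℝ (fderiv ℝ r) p :=
    (hr.fderiv_right (m := 1) (by norm_num)).differentiableAt (by simp)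
  have hαu : DifferentiableAt ℝ (JStarDr J u) p := hd2u.clm_comp hJ
  have hαr : DifferentiableAt ℝ (JStarDr J r) p := hd2r.clm_comp hJ
  have hfin := (hαu.hasFDerivAt.sub
    (((hexp p hrd.self_of_nhds).const_mul (ε * A)).smul hαr.hasFDerivAt)).fderiv
  have hJJ : J p (J p v) = -v := by
    have := congrArg (fun L => L v) hJ2
    simpa using this
  unfold LeviForm
  have e' := e.fderiv_eq.trans hfin
  rw [e']
  have a1 : JStarDr J r p (J p v) = - fderiv ℝ r p v := by simp [JStarDr, hJJ]
  have a2 : JStarDr J r p v = fderiv ℝ r p (J p v) := by simp [JStarDr]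
  simp [a1, a2]
  ring

theorem ball_infDist_frontier {n : ℕ} {D : Set (Cn n)} (hD : IsOpen D) {z : Cn n} (hz : z ∈ D) :
    ball z (infDist z (frontier D)) ⊆ D := by
  rcases (infDist_nonneg : 0 ≤ infDist z (frontier D)).eq_or_lt with h0 | h0
  · rw [← h0]; simp
  have hpre : IsPreconnected (ball z (infDist z (frontier D))) :=
    (convex_ball z (infDist z (frontier D))).isPreconnected
  refine hpre.subset_left_of_subset_union hD (isClosed_closure (s := D)).isOpen_compl ?_ ?_ ?_
  · exact Set.disjoint_left.2 fun x hx hx' => hx' (subset_closure hx)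
  · intro x hx
    by_contra hcon
    rw [Set.mem_union, not_or, Set.mem_compl_iff, not_not] at hcon
    have : x ∈ frontier D := by
      rw [hD.frontier_eq]; exact ⟨hcon.2, hcon.1⟩
    exact ball_infDist_subset_compl hx this
  · exact ⟨z, mem_ball_self h0, hz⟩

theorem def_contDiffAt {n : ℕ} {D Ω : Set (Cn n)} {ρ : Cn n → ℝ} (h : DefiningFunction D Ω ρ)
    {x : Cn n} (hx : x ∈ closure D) : ContDiffAt ℝ (⊤ : ℕ∞) ρ x :=
  (h.2.2.1 x (h.2.1 hx)).contDiffAt (h.1.mem_nhds (h.2.1 hx))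

theorem def_contOn {n : ℕ} {D Ω : Set (Cn n)} {ρ : Cn n → ℝ} (h : DefiningFunction D Ω ρ) :
    ContinuousOn (fderiv ℝ ρ) (closure D) := fun x hx =>
  ((def_contDiffAt h hx).fderiv_right (m := 1) one_add_one_le_smooth).continuousAt.continuousWithinAt

theorem def_neg {n : ℕ} {D Ω : Set (Cn n)} {ρ : Cn n → ℝ} (h : DefiningFunction D Ω ρ)
    {x : Cn n} (hx : x ∈ D) : ρ x < 0 := by
  have := h.2.2.2.1
  rw [this] at hx
  exact hx.2

theorem def_mem {n : ℕ} {D Ω : Set (Cn n)} {ρ : Cn n → ℝ} (h : DefiningFunction D Ω ρ)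
    {x : Cn n} (hx : x ∈ closure D) (hn : ρ x < 0) : x ∈ D := by
  have := h.2.2.2.1
  rw [this]
  exact ⟨h.2.1 hx, hn⟩

theorem def_frontier {n : ℕ} {D Ω : Set (Cn n)} {ρ : Cn n → ℝ} (h : DefiningFunction D Ω ρ)
    (hD : IsOpen D) {x : Cn n} (hx : x ∈ frontier D) : ρ x = 0 := by
  have hcl : x ∈ closure D := frontier_subset_closure hx
  have hxD : x ∉ D := by
    rw [hD.frontier_eq] at hx; exact hx.2
  refine le_antisymm ?_ ?_
  · have hc : ContinuousWithinAt ρ D x := (def_contDiffAt h hcl).continuousAt.continuousWithinAt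
    have := hc.mem_closure_image hcl
    have h2 : closure (ρ '' D) ⊆ Iic 0 := by
      refine closure_minimal ?_ isClosed_Iic
      rintro _ ⟨y, hy, rfl⟩
      exact (def_neg h hy).le
    exact h2 this
  · by_contra! hn
    exact hxD (def_mem h hcl hn)

theorem isCompact_cl {n : ℕ} {D : Set (Cn n)} (hb : IsBounded D) : IsCompact (closure D) :=
  hb.isCompact_closure

/-- The defining function is bounded by the distance to the boundary. -/
theorem def_le_dist {n : ℕ} {D Ω : Set (Cn n)} {ρ : Cn n → ℝ} (h : DefiningFunction D Ω ρ)
    (hD : IsOpen D) (hb : IsBounded D) (hne : (frontier D).Nonempty) :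
    ∃ C : ℝ, 0 < C ∧ ∀ z ∈ D, -ρ z ≤ C * infDist z (frontier D) := by
  obtain ⟨M, hM⟩ := (isCompact_cl hb).exists_bound_of_continuousOn (def_contOn h)
  refine ⟨max M 1, by positivity, fun z hz => ?_⟩
  obtain ⟨q, hq, hqd⟩ := isClosed_frontier.exists_infDist_eq_dist hne z
  have hsub : closedBall z (infDist z (frontier D)) ⊆ closure D := by
    rcases (infDist_nonneg : 0 ≤ infDist z (frontier D)).eq_or_lt with h0 | h0
    · rw [← h0]; simpa using subset_closure hz
    · rw [← closure_ball z h0.ne']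
      exact closure_mono (ball_infDist_frontier hD hz)
  have key := (convex_closedBall z (infDist z (frontier D))).norm_image_sub_le_of_norm_fderiv_le
    (𝕜 := ℝ) (f := ρ) (C := max M 1)
    (fun x hx => (def_contDiffAt h (hsub hx)).differentiableAt (by simp))
    (fun x hx => (hM x (hsub hx)).trans (le_max_left _ _))
    (mem_closedBall_self infDist_nonneg) (y := q)
    (by rw [mem_closedBall, dist_comm, hqd])
  rw [def_frontier h hD hq, ← dist_eq_norm q z, dist_comm q z, ← hqd] at key
  have := Real.le_norm_self (0 - ρ z)
  linarith

/-- The distance to the boundary is bounded by the defining function. -/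
theorem dist_le_def {n : ℕ} {D Ω : Set (Cn n)} {ρ : Cn n → ℝ} (h : DefiningFunction D Ω ρ)
    (hD : IsOpen D) (hb : IsBounded D) :
    ∃ C : ℝ, 0 < C ∧ ∀ z ∈ D, infDist z (frontier D) ≤ C * (-ρ z) := by
  suffices H : ∃ C : ℝ, 0 < C ∧ ∀ z ∈ closure D ∩ D, infDist z (frontier D) ≤ C * (-ρ z) by
    obtain ⟨C, hC, H⟩ := H
    exact ⟨C, hC, fun z hz => H z ⟨subset_closure hz, hz⟩⟩
  refine (isCompact_cl hb).induction_on
    (p := fun S => ∃ C : ℝ, 0 < C ∧ ∀ z ∈ S ∩ D, infDist z (frontier D) ≤ C * (-ρ z))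
    ⟨1, one_pos, by simp⟩ ?_ ?_ ?_
  · rintro s t hst ⟨C, hC, H⟩
    exact ⟨C, hC, fun z hz => H z ⟨hst hz.1, hz.2⟩⟩
  · rintro s t ⟨C, hC, H⟩ ⟨C', hC', H'⟩
    refine ⟨max C C', lt_max_of_lt_left hC, ?_⟩
    rintro z ⟨hz | hz, hzD⟩
    · refine (H z ⟨hz, hzD⟩).trans ?_
      have := def_neg h hzD
      gcongr
      · linarith
      · exact le_max_left _ _
    · refine (H' z ⟨hz, hzD⟩).trans ?_
      have := def_neg h hzD
      gcongr
      · linarith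
      · exact le_max_right _ _
  · intro p hp
    by_cases hpD : p ∈ D
    · have hρp := def_neg h hpD
      have hc : ContinuousAt ρ p := (def_contDiffAt h hp).continuousAt
      have hc2 : ContinuousAt (fun z => infDist z (frontier D)) p :=
        (continuous_infDist_pt _).continuousAt
      have e1 : ∀ᶠ z in 𝓝 p, ρ z < ρ p / 2 := hc.eventually_lt_const (by linarith)
      have e2 : ∀ᶠ z in 𝓝 p, infDist z (frontier D) < infDist p (frontier D) + 1 :=
        hc2.eventually_lt_const (by linarith)
      have hi : 0 ≤ infDist p (frontier D) := infDist_nonneg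
      refine ⟨_, mem_nhdsWithin_of_mem_nhds (e1.and e2),
        (infDist p (frontier D) + 1) / (-ρ p / 2), div_pos (by linarith) (by linarith), ?_⟩
      rintro z ⟨⟨h1, h2⟩, hz⟩
      refine h2.le.trans ?_
      rw [div_mul_eq_mul_div, le_div_iff₀ (by linarith)]
      gcongr
      linarith
    · have hpf : p ∈ frontier D := by rw [hD.frontier_eq]; exact ⟨hp, hpD⟩
      have hne := h.2.2.2.2 p hpf
      obtain ⟨e, he⟩ : ∃ e, 0 < fderiv ℝ ρ p e := by
        by_contra! hcon
        apply hne
        ext e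
        have h1 := hcon e
        have h2 := hcon (-e)
        rw [map_neg] at h2
        simp only [zero_apply]
        linarith
      have he0 : 0 < ‖e‖ := by
        rw [norm_pos_iff]; rintro rfl; simp at he
      have hcd : ContinuousAt (fun x => fderiv ℝ ρ x e) p :=
        (((def_contDiffAt h hp).fderiv_right (m := 1) one_add_one_le_smooth).continuousAt).clm_apply
          continuousAt_const
      have e1 : ∀ᶠ x in 𝓝 p, fderiv ℝ ρ p e / 2 < fderiv ℝ ρ x e :=
        hcd.eventually_const_lt (by linarith)
      have e2 : ∀ᶠ x in 𝓝 p, x ∈ Ω := h.1.mem_nhds (h.2.1 hp)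
      obtain ⟨r, hr, hball⟩ := Metric.eventually_nhds_iff_ball.1 (e1.and e2)
      refine ⟨ball p (r/2), mem_nhdsWithin_of_mem_nhds (ball_mem_nhds p (by linarith)),
        2 * ‖e‖ / (fderiv ℝ ρ p e / 2), by positivity, ?_⟩
      rintro z ⟨hzp, hzD⟩
      set d := infDist z (frontier D) with hd
      have hdr : d < r / 2 := (infDist_le_dist_of_mem hpf).trans_lt hzp
      have hρz := def_neg h hzD
      rcases (infDist_nonneg : 0 ≤ infDist z (frontier D)).eq_or_lt with h0 | h0
      · rw [hd, ← h0]
        have : 0 ≤ -ρ z := by linarith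
        positivity
      have hsub : ball z d ⊆ ball p r := by
        apply ball_subset_ball'
        rw [mem_ball] at hzp
        linarith
      let T := d / (2 * ‖e‖)
      have hT : 0 < T := by positivity
      have hmem : z + T • e ∈ ball z d := by
        rw [mem_ball, dist_eq_norm, add_sub_cancel_left, norm_smul, Real.norm_of_nonneg hT.le]
        have : T * ‖e‖ = d / 2 := by simp only [T]; field_simp
        rw [this]; linarith
      obtain ⟨ξ, hξ, hval⟩ := domain_mvt (f := ρ) (s := ball z d) (x := z) (y := z + T • e)
        (f' := fderiv ℝ ρ)
        (fun x hx => (((h.2.2.1 x (hball x (hsub hx)).2).contDiffAt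
          (h.1.mem_nhds (hball x (hsub hx)).2)).differentiableAt
            (by simp)).hasFDerivAt.hasFDerivWithinAt)
        (convex_ball z d) (mem_ball_self h0) hmem
      have hξ' : ξ ∈ ball z d := (convex_ball z d).segment_subset (mem_ball_self h0) hmem hξ
      have h1 := (hball ξ (hsub hξ')).1
      have h2 := def_neg h (ball_infDist_frontier hD hzD hmem)
      rw [add_sub_cancel_left, map_smul, smul_eq_mul] at hval
      have h3 : T * (fderiv ℝ ρ p e / 2) ≤ -ρ z := by
        have : T * (fderiv ℝ ρ p e / 2) ≤ T * fderiv ℝ ρ ξ e := by gcongr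
        linarith
      have h4 : d = 2 * ‖e‖ / (fderiv ℝ ρ p e / 2) * (T * (fderiv ℝ ρ p e / 2)) := by
        simp only [T]; field_simp
      calc d = _ := h4
        _ ≤ _ := by gcongr

/-- A Hopf lemma. -/
theorem hopf {n : ℕ} {D Ω Ωρ : Set (Cn n)} {ρ u : Cn n → ℝ} {J : Cn n → Cn n →L[ℝ] Cn n}
    (h : DefiningFunction D Ωρ ρ) (hD : IsOpen D) (hb : IsBounded D)
    (hΩ : IsOpen Ω) (hDΩ : closure D ⊆ Ω) (hJ : IsACS Ω J)
    (hu : ∀ x ∈ D, ContDiffAt ℝ 2 u x) (hneg : ∀ x ∈ D, u x < 0)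
    {K0 : Set (Cn n)} (hK0 : IsCompact K0) (hK0D : K0 ⊆ D)
    (hL : ∀ x ∈ D, x ∉ K0 → ∀ v, v ≠ 0 → 0 < LeviForm J u x v) :
    ∃ C : ℝ, 0 < C ∧ ∀ z ∈ D, -ρ z ≤ C * (-u z) := by
  have hcl := isCompact_cl hb
  have hJat : ∀ x ∈ closure D, ContDiffAt ℝ (⊤ : ℕ∞) J x := fun x hx =>
    (hJ.1 x (hDΩ hx)).contDiffAt (hΩ.mem_nhds (hDΩ hx))
  -- critical points
  let S := closure D ∩ (fderiv ℝ ρ) ⁻¹' {0}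
  have hS : IsCompact S :=
    hcl.of_isClosed_subset ((def_contOn h).preimage_isClosed_of_isClosed isClosed_closure
      isClosed_singleton) inter_subset_left
  have hSD : S ⊆ D := by
    rintro x ⟨hx, hx0⟩
    by_contra hxD
    exact h.2.2.2.2 x (by rw [hD.frontier_eq]; exact ⟨hx, hxD⟩) hx0
  obtain ⟨K, hK, hKi, hKD⟩ := exists_compact_between (hS.union hK0) hD (union_subset hSD hK0D)
  -- uniform constant
  have hN : IsCompact (closure D \ interior K) := hcl.diff isOpen_interior
  have hA : ∃ A : ℝ, 0 < A ∧ ∀ x ∈ closure D \ interior K, ∃ w : Cn n,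
      fderiv ℝ ρ x w ≠ 0 ∧ LeviForm J ρ x w ≤ A * (fderiv ℝ ρ x w) ^ 2 := by
    refine hN.induction_on (p := fun S => ∃ A : ℝ, 0 < A ∧ ∀ x ∈ S, ∃ w : Cn n,
      fderiv ℝ ρ x w ≠ 0 ∧ LeviForm J ρ x w ≤ A * (fderiv ℝ ρ x w) ^ 2)
      ⟨1, one_pos, by simp⟩ ?_ ?_ ?_
    · rintro s t hst ⟨A, hA, H⟩
      exact ⟨A, hA, fun x hx => H x (hst hx)⟩
    · rintro s t ⟨A, hA, H⟩ ⟨A', hA', H'⟩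
      refine ⟨max A A', lt_max_of_lt_left hA, ?_⟩
      rintro x (hx | hx)
      · obtain ⟨w, hw, hw2⟩ := H x hx
        refine ⟨w, hw, hw2.trans ?_⟩
        gcongr
        exact le_max_left _ _
      · obtain ⟨w, hw, hw2⟩ := H' x hx
        refine ⟨w, hw, hw2.trans ?_⟩
        gcongr
        exact le_max_right _ _
    · rintro p ⟨hp, hpK⟩
      have hp0 : fderiv ℝ ρ p ≠ 0 := fun h0 => hpK (hKi (Or.inl ⟨hp, h0⟩))
      obtain ⟨w, hw⟩ : ∃ w, fderiv ℝ ρ p w ≠ 0 := by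
        by_contra! hcon
        exact hp0 (by ext w; simpa using hcon w)
      have hdρ : ContDiffAt ℝ 1 (fderiv ℝ ρ) p :=
        (def_contDiffAt h hp).fderiv_right one_add_one_le_smooth
      have hJ1 : ContDiffAt ℝ 1 J p := (hJat p hp).of_le one_le_smooth
      have hα : ContDiffAt ℝ 1 (JStarDr J ρ) p := hdρ.clm_comp hJ1
      have hαc : ContinuousAt (fderiv ℝ (JStarDr J ρ)) p :=
        (hα.fderiv_right (m := 0) (by simp)).continuousAt
      have hJw : ContinuousAt (fun x => J x w) p := hJ1.continuousAt.clm_apply continuousAt_const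
      have hLc : ContinuousAt (fun x => LeviForm J ρ x w) p := by
        unfold LeviForm
        exact (((hαc.clm_apply continuousAt_const).clm_apply hJw).sub
          ((hαc.clm_apply hJw).clm_apply continuousAt_const)).neg
      have hwc : ContinuousAt (fun x => fderiv ℝ ρ x w) p :=
        hdρ.continuousAt.clm_apply continuousAt_const
      have hpos : 0 < (fderiv ℝ ρ p w) ^ 2 := by positivity
      let A := (|LeviForm J ρ p w| + 1) / (fderiv ℝ ρ p w) ^ 2
      have hlt : LeviForm J ρ p w < A * (fderiv ℝ ρ p w) ^ 2 := by
        simp only [A]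
        rw [div_mul_cancel₀ _ hpos.ne']
        linarith [le_abs_self (LeviForm J ρ p w)]
      have e1 : ∀ᶠ x in 𝓝 p, LeviForm J ρ x w < A * (fderiv ℝ ρ x w) ^ 2 :=
        hLc.eventually_lt ((hwc.pow 2).const_mul A) hlt
      have e2 : ∀ᶠ x in 𝓝 p, fderiv ℝ ρ x w ≠ 0 := hwc.eventually_ne hw
      refine ⟨_, mem_nhdsWithin_of_mem_nhds (e1.and e2), A, by positivity, ?_⟩
      rintro x ⟨h1, h2⟩
      exact ⟨w, h2, h1.le⟩
  obtain ⟨A, hA, HA⟩ := hA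
  have hucont : ContinuousOn u D := fun x hx => (hu x hx).continuousAt.continuousWithinAt
  have hρcont : ContinuousOn ρ (closure D) :=
    fun x hx => (def_contDiffAt h hx).continuousAt.continuousWithinAt
  -- choose epsilon
  obtain ⟨ε, hε, hεK⟩ : ∃ ε : ℝ, 0 < ε ∧ ∀ x ∈ K, u x ≤ ε * (1 - Real.exp (-A * ρ x)) := by
    have hc : ContinuousOn (fun x => (Real.exp (-A * ρ x) - 1) / (-u x)) K := by
      refine ContinuousOn.div ?_ (hucont.mono hKD).neg ?_
      · exact ((Real.continuous_exp.comp_continuousOn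
          ((hρcont.mono (hKD.trans subset_closure)).const_mul (-A)))).sub continuousOn_const
      · intro x hx
        have := hneg x (hKD hx)
        simp only [ne_eq, neg_eq_zero]; exact this.ne
    obtain ⟨M, hM⟩ := hK.exists_bound_of_continuousOn hc
    refine ⟨(max M 1)⁻¹, by positivity, fun x hx => ?_⟩
    have h1 := (Real.le_norm_self _).trans ((hM x hx).trans (le_max_left M 1))
    have hux := hneg x (hKD hx)
    rw [div_le_iff₀ (by linarith)] at h1
    have hm : 0 < max M 1 := by positivity
    rw [inv_mul_eq_div, le_div_iff₀ hm]
    linarith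
  -- comparison
  have hcomp : ∀ z ∈ D, u z ≤ ε * (1 - Real.exp (-A * ρ z)) := by
    by_contra! hcon
    obtain ⟨z, hz, hzgt⟩ := hcon
    let F : Cn n → ℝ := fun x => u x - ε * (1 - Real.exp (-A * ρ x))
    let B : Cn n → ℝ := fun x => - (ε * (1 - Real.exp (-A * ρ x)))
    have hFz : 0 < F z := by simp only [F]; linarith
    have hBc : ContinuousOn B (closure D) :=
      ((continuousOn_const.sub (Real.continuous_exp.comp_continuousOn
        (hρcont.const_mul (-A)))).const_mul ε).neg
    let E := closure D ∩ B ⁻¹' (Ici (F z))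
    have hE : IsCompact E :=
      hcl.of_isClosed_subset (hBc.preimage_isClosed_of_isClosed isClosed_closure isClosed_Ici)
        inter_subset_left
    have hED : E ⊆ D := by
      rintro x ⟨hx, hxB⟩
      apply def_mem h hx
      by_contra! hρ
      have : Real.exp (-A * ρ x) ≤ 1 := Real.exp_le_one_iff.2 (by nlinarith)
      have hB : B x ≤ 0 := by
        simp only [B]
        have : 0 ≤ ε * (1 - Real.exp (-A * ρ x)) := mul_nonneg hε.le (by linarith)
        linarith
      have : F z ≤ B x := hxB
      linarith
    have hFB : ∀ x ∈ D, F x < B x := fun x hx => by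
      have := hneg x hx
      simp only [F, B]; linarith
    have hzE : z ∈ E := ⟨subset_closure hz, (hFB z hz).le⟩
    have hFc : ContinuousOn F E := by
      have : F = fun x => u x + B x := by
        funext x; simp only [F, B]; ring
      rw [this]
      exact (hucont.mono hED).add (hBc.mono (hED.trans subset_closure))
    obtain ⟨x0, hx0, hmax⟩ := hE.exists_isMaxOn ⟨z, hzE⟩ hFc
    have hx0D := hED hx0
    have hx0F : F z ≤ F x0 := hmax hzE
    have hloc : IsLocalMax F x0 := by
      filter_upwards [hD.mem_nhds hx0D] with y hy
      by_cases hyE : y ∈ E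
      · exact hmax hyE
      · have : B y < F z := by
          by_contra! hcon
          exact hyE ⟨subset_closure hy, hcon⟩
        linarith [hFB y hy]
    have hx0K : x0 ∉ K := fun hk => by
      have := hεK x0 hk
      have h2 : 0 < F x0 := by linarith
      simp only [F] at h2
      linarith
    obtain ⟨w, hw, hwA⟩ := HA x0 ⟨subset_closure hx0D, fun hk => hx0K (interior_subset hk)⟩
    have hw0 : w ≠ 0 := by rintro rfl; simp at hw
    have hLu := hL x0 hx0D (fun hk => hx0K (interior_subset (hKi (Or.inr hk)))) w hw0
    have hρ2 : ContDiffAt ℝ 2 ρ x0 :=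
      (def_contDiffAt h (subset_closure hx0D)).of_le two_le_smooth
    have hJd : DifferentiableAt ℝ J x0 :=
      (hJat x0 (subset_closure hx0D)).differentiableAt (by simp)
    have hJ2 := hJ.2 x0 (hDΩ (subset_closure hx0D))
    have hF2 : ContDiffAt ℝ 2 F x0 :=
      (hu x0 hx0D).sub (contDiffAt_const.mul (contDiffAt_const.sub
        ((contDiffAt_const.mul hρ2).exp)))
    have h1 := levi_nonpos hF2 hJd hJ2 hloc w
    rw [levi_barrier (hu x0 hx0D) hρ2 hJd hJ2 A ε w] at h1
    have h2 : LeviForm J ρ x0 w - A * ((fderiv ℝ ρ x0 w) ^ 2 + (fderiv ℝ ρ x0 (J x0 w)) ^ 2) ≤ 0 := by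
      have : 0 ≤ A * (fderiv ℝ ρ x0 (J x0 w)) ^ 2 := by positivity
      linarith
    have h3 : 0 ≤ ε * A * Real.exp (-A * ρ x0) := by positivity
    have := mul_nonpos_of_nonneg_of_nonpos h3 h2
    linarith
  refine ⟨(ε * A)⁻¹, by positivity, fun z hz => ?_⟩
  have h1 := hcomp z hz
  have h2 := Real.add_one_le_exp (-A * ρ z)
  rw [inv_mul_eq_div, le_div_iff₀ (by positivity)]
  nlinarith

theorem one_side {n : ℕ} (D D' : Set (Cn n))
    (Ω Ω' : Set (Cn n)) (hΩ : IsOpen Ω) (hΩ' : IsOpen Ω')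
    (hDΩ : closure D ⊆ Ω) (hD'Ω' : closure D' ⊆ Ω')
    (J J' : Cn n → Cn n →L[ℝ] Cn n) (hJ : IsACS Ω J) (hJ' : IsACS Ω' J')
    (hD : StrictlyPseudoconvexDomain J D) (hD' : StrictlyPseudoconvexDomain J' D')
    (f g : Cn n → Cn n)
    (hf : ContDiffOn ℝ (⊤ : ℕ∞) f D) (hg : ContDiffOn ℝ (⊤ : ℕ∞) g D')
    (hfD : MapsTo f D D') (hgD : MapsTo g D' D)
    (hgf : ∀ x ∈ D, g (f x) = x)
    (hfhol : PseudoHolOn J J' f D) (hne : (frontier D').Nonempty) :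
    ∃ C : ℝ, 0 < C ∧ ∀ z ∈ D,
      infDist z (frontier D) ≤ C * infDist (f z) (frontier D') := by
  obtain ⟨hDo, -, hDb, Ωρ, ρ, hρ, -, -⟩ := hD
  obtain ⟨hD'o, -, hD'b, Ωρ', ρ', hρ', -, W, hW, hfW, hWs⟩ := hD'
  obtain ⟨C1, hC1, H1⟩ := dist_le_def hρ hDo hDb
  obtain ⟨C3, hC3, H3⟩ := def_le_dist hρ' hD'o hD'b hne
  have hfat : ∀ x ∈ D, ContDiffAt ℝ (⊤ : ℕ∞) f x := fun x hx =>
    (hf x hx).contDiffAt (hDo.mem_nhds hx)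
  have hgat : ∀ x ∈ D', ContDiffAt ℝ (⊤ : ℕ∞) g x := fun x hx =>
    (hg x hx).contDiffAt (hD'o.mem_nhds hx)
  have hK' : IsCompact (closure D' \ W) := (isCompact_cl hD'b).diff hW
  have hK'D : closure D' \ W ⊆ D' := by
    rintro x ⟨hx, hxW⟩
    by_contra hxD
    exact hxW (hfW (by rw [hD'o.frontier_eq]; exact ⟨hx, hxD⟩))
  have hρ'2 : ∀ x ∈ D, ContDiffAt ℝ 2 ρ' (f x) := fun x hx =>
    (def_contDiffAt hρ' (subset_closure (hfD hx))).of_le two_le_smooth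
  have hf2 : ∀ x ∈ D, ContDiffAt ℝ 2 f x := fun x hx =>
    (hfat x hx).of_le two_le_smooth
  obtain ⟨C2, hC2, H2⟩ := hopf (u := fun x => ρ' (f x)) (K0 := g '' (closure D' \ W)) hρ hDo hDb hΩ
    hDΩ hJ
    (fun x hx => (hρ'2 x hx).comp x (hf2 x hx)) (fun x hx => def_neg hρ' (hfD hx))
    (hK'.image_of_continuousOn (hg.continuousOn.mono hK'D))
    (by rintro _ ⟨y, hy, rfl⟩; exact hgD (hK'D hy))
    (by
      intro x hx hxK v hv
      have hJd : DifferentiableAt ℝ J' (f x) :=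
        ((hJ'.1 _ (hD'Ω' (subset_closure (hfD hx)))).contDiffAt
          (hΩ'.mem_nhds (hD'Ω' (subset_closure (hfD hx))))).differentiableAt (by simp)
      rw [levi_comp (J' := J') (hρ'2 x hx) (hf2 x hx) hJd
        (by filter_upwards [hDo.mem_nhds hx] with y hy using (hfhol y hy).2)]
      apply hWs
      · by_contra hfxW
        exact hxK ⟨f x, ⟨subset_closure (hfD hx), hfxW⟩, hgf x hx⟩
      · intro h0
        apply hv
        have hc : HasFDerivAt (g ∘ f) ((fderiv ℝ g (f x)).comp (fderiv ℝ f x)) x :=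
          ((hgat _ (hfD hx)).differentiableAt (by simp)).hasFDerivAt.comp x
            (hfhol x hx).1.hasFDerivAt
        have hid : HasFDerivAt (g ∘ f) (ContinuousLinearMap.id ℝ (Cn n)) x := by
          refine (hasFDerivAt_id x).congr_of_eventuallyEq ?_
          filter_upwards [hDo.mem_nhds hx] with y hy using hgf y hy
        have := congrArg (fun L => L v) (hc.unique hid)
        simp only [ContinuousLinearMap.comp_apply, h0, map_zero] at this
        exact this.symm)
  refine ⟨C1 * (C2 * C3), by positivity, fun z hz => ?_⟩
  calc infDist z (frontier D) ≤ C1 * (-ρ z) := H1 z hz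
    _ ≤ C1 * (C2 * (-ρ' (f z))) := by gcongr; exact H2 z hz
    _ ≤ C1 * (C2 * (C3 * infDist (f z) (frontier D'))) := by gcongr; exact H3 _ (hfD hz)
    _ = _ := by ring

/-- **Boundary distance preserving property** (Proposition 1.4.8): a `(J,J')`-biholomorphism
between bounded strictly pseudoconvex domains satisfies
`(1/C) dist(f(z),∂D') ≤ dist(z,∂D) ≤ C dist(f(z),∂D')`. -/
theorem boundary_distance_preserving {n : ℕ} (D D' : Set (Cn n))
    (Ω Ω' : Set (Cn n)) (hΩ : IsOpen Ω) (hΩ' : IsOpen Ω')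
    (hDΩ : closure D ⊆ Ω) (hD'Ω' : closure D' ⊆ Ω')
    (J J' : Cn n → Cn n →L[ℝ] Cn n) (hJ : IsACS Ω J) (hJ' : IsACS Ω' J')
    (hD : StrictlyPseudoconvexDomain J D) (hD' : StrictlyPseudoconvexDomain J' D')
    (f g : Cn n → Cn n)
    (hf : ContDiffOn ℝ (⊤ : ℕ∞) f D) (hg : ContDiffOn ℝ (⊤ : ℕ∞) g D')
    (hfD : MapsTo f D D') (hgD : MapsTo g D' D)
    (hgf : ∀ x ∈ D, g (f x) = x) (hfg : ∀ y ∈ D', f (g y) = y)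
    (hfhol : PseudoHolOn J J' f D) :
    ∃ C : ℝ, 0 < C ∧ ∀ z ∈ D,
      (1 / C) * infDist (f z) (frontier D') ≤ infDist z (frontier D) ∧
      infDist z (frontier D) ≤ C * infDist (f z) (frontier D') := by
  rcases Nat.eq_zero_or_pos n with hn | hn
  · subst hn
    have hz : ∀ (x : Cn 0) (s : Set (Cn 0)), infDist x s = 0 := by
      intro x s
      rcases s.eq_empty_or_nonempty with rfl | ⟨y, hy⟩
      · exact infDist_empty
      · rw [Subsingleton.elim x y]; exact infDist_zero_of_mem hy
    exact ⟨1, one_pos, fun z _ => by simp [hz]⟩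
  have : Nonempty (Fin n) := ⟨⟨0, hn⟩⟩
  have : Nontrivial (Cn n) := inferInstance
  have hfr : ∀ (J : Cn n → Cn n →L[ℝ] Cn n) (S : Set (Cn n)),
      StrictlyPseudoconvexDomain J S → (frontier S).Nonempty := by
    intro J S hS
    rw [nonempty_frontier_iff]
    refine ⟨hS.2.1.nonempty, fun hu => ?_⟩
    have hb := hS.2.2.1
    rw [hu] at hb
    exact NormedSpace.unbounded_univ ℝ (Cn n) hb
  have hghol : PseudoHolOn J' J g D' := by
    intro y hy
    have hDo := hD.1
    have hD'o := hD'.1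
    have hgd : DifferentiableAt ℝ g y :=
      ((hg y hy).contDiffAt (hD'o.mem_nhds hy)).differentiableAt (by simp)
    refine ⟨hgd, ?_⟩
    obtain ⟨hfd, hfe⟩ := hfhol (g y) (hgD hy)
    rw [hfg y hy] at hfe
    have h1 : (fderiv ℝ f (g y)).comp (fderiv ℝ g y) = ContinuousLinearMap.id ℝ (Cn n) := by
      refine (hfd.hasFDerivAt.comp y hgd.hasFDerivAt).unique ?_
      refine (hasFDerivAt_id y).congr_of_eventuallyEq ?_
      filter_upwards [hD'o.mem_nhds hy] with x hx using hfg x hx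
    have h2 : (fderiv ℝ g y).comp (fderiv ℝ f (g y)) = ContinuousLinearMap.id ℝ (Cn n) := by
      have hgd' : HasFDerivAt g (fderiv ℝ g y) (f (g y)) := by
        rw [hfg y hy]; exact hgd.hasFDerivAt
      refine (hgd'.comp (g y) hfd.hasFDerivAt).unique ?_
      refine (hasFDerivAt_id (g y)).congr_of_eventuallyEq ?_
      filter_upwards [hDo.mem_nhds (hgD hy)] with x hx using hgf x hx
    calc (fderiv ℝ g y).comp (J' y)
        = (fderiv ℝ g y).comp (((J' y).comp (fderiv ℝ f (g y))).comp (fderiv ℝ g y)) := by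
          rw [ContinuousLinearMap.comp_assoc, h1, ContinuousLinearMap.comp_id]
      _ = ((fderiv ℝ g y).comp (fderiv ℝ f (g y))).comp ((J (g y)).comp (fderiv ℝ g y)) := by
          rw [← hfe]; rfl
      _ = _ := by rw [h2, ContinuousLinearMap.id_comp]
  obtain ⟨C1, hC1, H1⟩ := one_side D D' Ω Ω' hΩ hΩ' hDΩ hD'Ω' J J' hJ hJ' hD hD' f g hf hg hfD hgD
    hgf hfhol (hfr J' D' hD')
  obtain ⟨C2, hC2, H2⟩ := one_side D' D Ω' Ω hΩ' hΩ hD'Ω' hDΩ J' J hJ' hJ hD' hD g f hg hf hgD hfD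
    hfg hghol (hfr J D hD)
  refine ⟨max C1 C2, lt_max_of_lt_left hC1, fun z hz => ⟨?_, ?_⟩⟩
  · have h2 := H2 (f z) (hfD hz)
    rw [hgf z hz] at h2
    rw [one_div, inv_mul_eq_div, div_le_iff₀ (lt_max_of_lt_left hC1), mul_comm]
    refine h2.trans ?_
    gcongr
    · exact infDist_nonneg
    · exact le_max_right _ _
  · refine (H1 z hz).trans ?_
    gcongr
    · exact infDist_nonneg
    · exact le_max_left _ _
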